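/- Let G=(V,E,ω,μ) be an infinite, locally finite, connected weighted graph with D_μ<∞, let T>0, and let ψ:V→[0,∞) with ψ≢0. Let ū and u̲ be bounded upper and lower solutions of u_t − Δu = f(x,t,u) on V×(0,T], u(·,0)=ψ, and set η̲ = inf_{V×[0,T]} min{ū,u̲}, η̄ = sup_{V×[0,T]} max{ū,u̲}. Assume f(x,t,0)=0 for all (x,t), f(x,·,u) is continuous on [0,T] for each x∈V and u∈[η̲,η̄], and there is M>0 such that |f(x,t,u) − f(x,t,v)| ≤ M|u−v| for all (x,t)∈V×[0,T] and u,v∈[η̲,η̄]. Then the problem u_t − Δu = f(x,t,u) on V×(0,T], u(·,0)=ψ, admits a unique solution u, continuous in t on [0,T] and differentiable in t on (0,T] for each fixed x, satisfying u̲ ≤ u ≤ ū on V×[0,T]. -/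

import Mathlib

open Filter Topology Set
open scoped ENNReal Classical

noncomputable section

/-- The graph Laplacian `Δu(x) = (1/μ(x)) ∑_y ω(x,y) (u(y) − u(x))`. -/
def graphLap {V : Type*} (ω : V → V → ℝ) (μ : V → ℝ) (u : V → ℝ) (x : V) : ℝ :=
  (1 / μ x) * ∑' y, ω x y * (u y - u x)

/-- `(V, ω, μ)` is a locally finite connected weighted graph: `ω` is symmetric and
nonnegative (with `ω x y > 0` exactly for neighbours), there are no loops, every
vertex has finitely many neighbours, `μ > 0`, and the graph is connected. -/
structure IsWeightedGraph {V : Type*} (ω : V → V → ℝ) (μ : V → ℝ) : Prop where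
  symm : ∀ x y, ω x y = ω y x
  nonneg : ∀ x y, 0 ≤ ω x y
  loopless : ∀ x, ω x x = 0
  locallyFinite : ∀ x, {y | 0 < ω x y}.Finite
  measurePos : ∀ x, 0 < μ x
  connected : ∀ x y, Relation.ReflTransGen (fun a b => 0 < ω a b) x y

/-- `D_μ = sup_x m(x)/μ(x) < ∞`, where `m(x) = ∑_{y ∼ x} ω(x,y)`. -/
def DmuFinite {V : Type*} (ω : V → V → ℝ) (μ : V → ℝ) : Prop :=
  ∃ C : ℝ, ∀ x, (∑' y, ω x y) ≤ C * μ x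
/-- An upper solution of `u_t − Δu = f(x,t,u)` on `V × (0,T]`, `u(·,0) = ψ`,
with time derivative `u'`: bounded, continuous in `t` on `[0,T]`,
differentiable in `t` on `(0,T]`, with `u_t − Δu ≥ f(x,t,u)` and
`u(·,0) ≥ ψ`. -/
def IsUpperSol {V : Type*} (ω : V → V → ℝ) (μ : V → ℝ) (f : V → ℝ → ℝ → ℝ)
    (ψ : V → ℝ) (T : ℝ) (u u' : V → ℝ → ℝ) : Prop :=
  (∃ C : ℝ, ∀ x, ∀ t ∈ Icc (0:ℝ) T, |u x t| ≤ C) ∧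
  (∀ x, ContinuousOn (u x) (Icc (0:ℝ) T)) ∧
  (∀ x, ∀ t ∈ Ioc (0:ℝ) T, HasDerivWithinAt (u x) (u' x t) (Icc (0:ℝ) T) t) ∧
  (∀ x, ∀ t ∈ Ioc (0:ℝ) T, f x t (u x t) ≤ u' x t - graphLap ω μ (fun y => u y t) x) ∧
  (∀ x, ψ x ≤ u x 0)

/-- A lower solution of `u_t − Δu = f(x,t,u)` on `V × (0,T]`, `u(·,0) = ψ`. -/
def IsLowerSol {V : Type*} (ω : V → V → ℝ) (μ : V → ℝ) (f : V → ℝ → ℝ → ℝ)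
    (ψ : V → ℝ) (T : ℝ) (u u' : V → ℝ → ℝ) : Prop :=
  (∃ C : ℝ, ∀ x, ∀ t ∈ Icc (0:ℝ) T, |u x t| ≤ C) ∧
  (∀ x, ContinuousOn (u x) (Icc (0:ℝ) T)) ∧
  (∀ x, ∀ t ∈ Ioc (0:ℝ) T, HasDerivWithinAt (u x) (u' x t) (Icc (0:ℝ) T) t) ∧
  (∀ x, ∀ t ∈ Ioc (0:ℝ) T, u' x t - graphLap ω μ (fun y => u y t) x ≤ f x t (u x t)) ∧
  (∀ x, u x 0 ≤ ψ x)

section Laplacian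

variable {V : Type*} {ω : V → V → ℝ} {μ : V → ℝ}

theorem IsWeightedGraph.eq_zero_of_notMem (hG : IsWeightedGraph ω μ) {x y : V}
    (hy : y ∉ (hG.locallyFinite x).toFinset) : ω x y = 0 := by
  rw [Set.Finite.mem_toFinset, mem_ofPred_eq, not_lt] at hy
  exact le_antisymm hy (hG.nonneg x y)

theorem IsWeightedGraph.tsum_mul_eq_sum (hG : IsWeightedGraph ω μ) (x : V) (g : V → ℝ) :
    ∑' y, ω x y * g y = ∑ y ∈ (hG.locallyFinite x).toFinset, ω x y * g y :=
  tsum_eq_sum fun y hy => by rw [hG.eq_zero_of_notMem hy, zero_mul]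

theorem graphLap_eq_sum (hG : IsWeightedGraph ω μ) (u : V → ℝ) (x : V) :
    graphLap ω μ u x =
      (1 / μ x) * ∑ y ∈ (hG.locallyFinite x).toFinset, ω x y * (u y - u x) := by
  rw [graphLap, hG.tsum_mul_eq_sum]

theorem graphLap_sub (hG : IsWeightedGraph ω μ) (u v : V → ℝ) (x : V) :
    graphLap ω μ (fun y => u y - v y) x = graphLap ω μ u x - graphLap ω μ v x := by
  simp only [graphLap_eq_sum hG]
  rw [← mul_sub, ← Finset.sum_sub_distrib]
  congr 1
  exact Finset.sum_congr rfl fun y _ => by ring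

theorem graphLap_zero (x : V) : graphLap ω μ (fun _ => 0) x = 0 := by
  simp [graphLap]

/-- If every increment of `w` away from `x` is at least `-c`, then `Δw(x) ≥ -D c`. -/
theorem neg_mul_le_graphLap (hG : IsWeightedGraph ω μ) {D : ℝ}
    (hD : ∀ x, (∑' y, ω x y) ≤ D * μ x) {w : V → ℝ} {x : V} {c : ℝ} (hc : 0 ≤ c)
    (h : ∀ y, -c ≤ w y - w x) : -(D * c) ≤ graphLap ω μ w x := by
  have hμ := hG.measurePos x
  have hsum : ∑ y ∈ (hG.locallyFinite x).toFinset, ω x y ≤ D * μ x := by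
    have h1 := hG.tsum_mul_eq_sum x fun _ => 1
    simp only [mul_one] at h1
    exact h1 ▸ hD x
  rw [graphLap_eq_sum hG, one_div, inv_mul_eq_div, le_div_iff₀ hμ]
  calc -(D * c) * μ x = -(D * μ x * c) := by ring
    _ ≤ -((∑ y ∈ (hG.locallyFinite x).toFinset, ω x y) * c) := by gcongr
    _ = ∑ y ∈ (hG.locallyFinite x).toFinset, ω x y * (-c) := by
        rw [Finset.sum_mul, ← Finset.sum_neg_distrib]
        exact Finset.sum_congr rfl fun y _ => by ring
    _ ≤ _ := Finset.sum_le_sum fun y _ => mul_le_mul_of_nonneg_left (h y) (hG.nonneg x y)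

theorem abs_graphLap_le (hG : IsWeightedGraph ω μ) {D : ℝ}
    (hD : ∀ x, (∑' y, ω x y) ≤ D * μ x) {w : V → ℝ} {c : ℝ}
    (h : ∀ y, |w y| ≤ c) (x : V) : |graphLap ω μ w x| ≤ 2 * D * c := by
  have hc : 0 ≤ c := (abs_nonneg _).trans (h x)
  have hneg : graphLap ω μ (fun y => 0 - w y) x = -graphLap ω μ w x := by
    rw [graphLap_sub hG (fun _ => 0) w, graphLap_zero, zero_sub]
  have h1 := neg_mul_le_graphLap hG hD (w := w) (x := x) (c := 2 * c) (by linarith) fun y => by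
    linarith [abs_le.1 (h y), abs_le.1 (h x)]
  have h2 := neg_mul_le_graphLap hG hD (w := fun y => 0 - w y) (x := x) (c := 2 * c)
    (by linarith) fun y => by linarith [abs_le.1 (h y), abs_le.1 (h x)]
  rw [abs_le]
  constructor <;> linarith

theorem continuous_graphLap (hG : IsWeightedGraph ω μ) {u : V → ℝ → ℝ}
    (hu : ∀ x, Continuous (u x)) (x : V) :
    Continuous fun t => graphLap ω μ (fun y => u y t) x := by
  simp only [graphLap_eq_sum hG]
  have := hu
  fun_prop

end Laplacian

theorem HasDerivWithinAt.Icc_to_Ici {g : ℝ → ℝ} {d a b t : ℝ} (ht : t ∈ Ico a b)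
    (h : HasDerivWithinAt g d (Icc a b) t) : HasDerivWithinAt g d (Ici t) t :=
  h.mono_of_mem_nhdsWithin (mem_of_superset (Icc_mem_nhdsGE ht.2) (Icc_subset_Icc_left ht.1))

/-- A fencing principle requiring no derivative at the left end point. -/
theorem le_of_hasDerivWithinAt_Ioc {g g' B B' : ℝ → ℝ} {T : ℝ}
    (hg : ContinuousOn g (Icc 0 T))
    (hg' : ∀ t ∈ Ioc 0 T, HasDerivWithinAt g (g' t) (Icc 0 T) t)
    (h0 : g 0 < B 0) (hB : ∀ t, HasDerivAt B (B' t) t)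
    (bound : ∀ t ∈ Ioc 0 T, g t = B t → g' t < B' t) : ∀ t ∈ Icc 0 T, g t ≤ B t := by
  intro t ht
  have hT : 0 ≤ T := ht.1.trans ht.2
  have hBc : Continuous B := continuous_iff_continuousAt.2 fun s => (hB s).continuousAt
  have hev : ∀ᶠ s in 𝓝[Icc 0 T] 0, g s < B s :=
    (hg 0 ⟨le_rfl, hT⟩).eventually_lt hBc.continuousWithinAt h0
  obtain ⟨ε, hε, hlt⟩ := Metric.mem_nhdsWithin_iff.1 hev
  have hsmall : ∀ s ∈ Icc 0 T, s < ε → g s < B s := fun s hs hsε =>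
    hlt ⟨by rwa [Metric.mem_ball, Real.dist_eq, sub_zero, abs_of_nonneg hs.1], hs⟩
  by_cases htε : t < ε
  · exact (hsmall t ht htε).le
  push Not at htε
  have hsub : Icc (ε / 2) T ⊆ Icc 0 T := Icc_subset_Icc_left (by positivity)
  refine image_le_of_deriv_right_lt_deriv_boundary' (a := ε / 2) (b := T) (f' := g') (B' := B')
    (hg.mono hsub) (fun s hs => ?_) ?_ hBc.continuousOn
    (fun s _ => (hB s).hasDerivWithinAt) (fun s hs => ?_) ⟨by linarith, ht.2⟩
  · exact (hg' s ⟨by linarith [hs.1], hs.2.le⟩).Icc_to_Ici ⟨by linarith [hs.1], hs.2⟩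
  · exact (hsmall _ ⟨by positivity, by linarith [ht.2]⟩ (by linarith)).le
  · exact bound s ⟨by linarith [hs.1], hs.2.le⟩

/-- The minimum principle for bounded functions on a graph with `D_μ < ∞`. -/
theorem nonneg_of_graphLap_sub_le {V : Type*} {ω : V → V → ℝ} {μ : V → ℝ}
    (hG : IsWeightedGraph ω μ) {D : ℝ} (hD0 : 0 ≤ D) (hD : ∀ x, (∑' y, ω x y) ≤ D * μ x)
    {T K C : ℝ} (hK : 0 < K) {w w' : V → ℝ → ℝ}
    (hC : ∀ x, ∀ t ∈ Icc 0 T, |w x t| ≤ C)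
    (hw : ∀ x, ContinuousOn (w x) (Icc 0 T))
    (hw' : ∀ x, ∀ t ∈ Ioc 0 T, HasDerivWithinAt (w x) (w' x t) (Icc 0 T) t)
    (hineq : ∀ x, ∀ t ∈ Ioc 0 T,
      graphLap ω μ (fun y => w y t) x - K * |w x t| ≤ w' x t)
    (h0 : ∀ x, 0 ≤ w x 0) : ∀ x, ∀ t ∈ Icc 0 T, 0 ≤ w x t := by
  set lam : ℝ := 4 * (D + K) with hlam
  have hstep : ∀ N : ℝ, 0 < N → (∀ x, ∀ t ∈ Icc 0 T, -w x t ≤ N * Real.exp (lam * t)) →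
      ∀ x, ∀ t ∈ Icc 0 T, -w x t ≤ N / 2 * Real.exp (lam * t) := by
    intro N hN hNw x
    refine le_of_hasDerivWithinAt_Ioc (hw x).neg (fun t ht => (hw' x t ht).neg)
      (by simpa using (neg_nonpos.2 (h0 x)).trans_lt (half_pos hN))
      (B' := fun t => N / 2 * (Real.exp (lam * t) * lam)) (fun t => ?_) fun t ht heq => ?_
    · simpa using (((hasDerivAt_id t).const_mul lam).exp).const_mul (N / 2)
    · have hexp := Real.exp_pos (lam * t)
      have hNe : 0 < N * Real.exp (lam * t) := mul_pos hN hexp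
      have heq' : w x t = -(N * Real.exp (lam * t) / 2) := by
        linarith
      have hlap : -(D * (N * Real.exp (lam * t))) ≤ graphLap ω μ (fun y => w y t) x :=
        neg_mul_le_graphLap hG hD hNe.le fun y => by
          have := hNw y t ⟨ht.1.le, ht.2⟩
          linarith
      have habs : |w x t| = N * Real.exp (lam * t) / 2 := by
        rw [heq', abs_neg, abs_of_pos (half_pos hNe)]
      have := hineq x t ht
      rw [habs] at this
      have hprod : 0 < K * (N * Real.exp (lam * t)) := mul_pos hK hNe
      have hprod' : 0 ≤ D * (N * Real.exp (lam * t)) := mul_nonneg hD0 hNe.le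
      have : N / 2 * (Real.exp (lam * t) * lam)
          = 2 * (D * (N * Real.exp (lam * t))) + 2 * (K * (N * Real.exp (lam * t))) := by
        rw [hlam]; ring
      linarith
  have hall : ∀ n : ℕ, ∀ x, ∀ t ∈ Icc 0 T,
      -w x t ≤ (|C| + 1) * (1 / 2) ^ n * Real.exp (lam * t) := by
    intro n
    induction n with
    | zero =>
      intro x t ht
      have h1 : 1 ≤ Real.exp (lam * t) :=
        Real.one_le_exp (mul_nonneg (by rw [hlam]; positivity) ht.1)
      have h2 := (abs_le.1 (hC x t ht)).1
      have h3 := le_abs_self C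
      rw [pow_zero, mul_one]
      nlinarith [abs_nonneg C]
    | succ n ih =>
      intro x t ht
      have := hstep _ (by positivity) ih x t ht
      rw [pow_succ]
      linarith
  intro x t ht
  have hlim : Tendsto (fun n : ℕ => (|C| + 1) * (1 / 2 : ℝ) ^ n * Real.exp (lam * t)) atTop
      (𝓝 ((|C| + 1) * 0 * Real.exp (lam * t))) :=
    ((tendsto_pow_atTop_nhds_zero_of_lt_one (by norm_num) (by norm_num)).const_mul _).mul_const _
  have := ge_of_tendsto' hlim fun n => hall n x t ht
  simp only [mul_zero, zero_mul] at this
  linarith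

/-- The comparison principle for bounded sub- and supersolutions `q`, `p`. -/
theorem le_of_parabolic_le {V : Type*} {ω : V → V → ℝ} {μ : V → ℝ}
    (hG : IsWeightedGraph ω μ) {D : ℝ} (hD0 : 0 ≤ D) (hD : ∀ x, (∑' y, ω x y) ≤ D * μ x)
    {T M C C' : ℝ} (hM : 0 < M) {F : V → ℝ → ℝ → ℝ}
    (hF : ∀ x t a b, |F x t a - F x t b| ≤ M * |a - b|) {p p' q q' : V → ℝ → ℝ}
    (hpC : ∀ x, ∀ t ∈ Icc 0 T, |p x t| ≤ C) (hqC : ∀ x, ∀ t ∈ Icc 0 T, |q x t| ≤ C')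
    (hp : ∀ x, ContinuousOn (p x) (Icc 0 T)) (hq : ∀ x, ContinuousOn (q x) (Icc 0 T))
    (hp' : ∀ x, ∀ t ∈ Ioc 0 T, HasDerivWithinAt (p x) (p' x t) (Icc 0 T) t)
    (hq' : ∀ x, ∀ t ∈ Ioc 0 T, HasDerivWithinAt (q x) (q' x t) (Icc 0 T) t)
    (hpF : ∀ x, ∀ t ∈ Ioc 0 T, F x t (p x t) ≤ p' x t - graphLap ω μ (fun y => p y t) x)
    (hqF : ∀ x, ∀ t ∈ Ioc 0 T, q' x t - graphLap ω μ (fun y => q y t) x ≤ F x t (q x t))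
    (h0 : ∀ x, q x 0 ≤ p x 0) : ∀ x, ∀ t ∈ Icc 0 T, q x t ≤ p x t := by
  have := nonneg_of_graphLap_sub_le hG hD0 hD (C := C + C') hM
    (w := fun x t => p x t - q x t) (w' := fun x t => p' x t - q' x t)
    (fun x t ht => by linarith [abs_sub (p x t) (q x t), hpC x t ht, hqC x t ht])
    (fun x => (hp x).sub (hq x)) (fun x t ht => (hp' x t ht).sub (hq' x t ht))
    (fun x t ht => by
      rw [graphLap_sub hG]
      linarith [hpF x t ht, hqF x t ht, (abs_le.1 (hF x t (p x t) (q x t))).1])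
    (fun x => sub_nonneg.2 (h0 x))
  exact fun x t ht => sub_nonneg.1 (this x t ht)

/-- An integral bound for a continuous function dominated, up to a constant, by the derivative
of a bounded function. -/
theorem integral_le_of_sub_le_deriv {g u u' : ℝ → ℝ} {T C c : ℝ} (hg : Continuous g)
    (hc : 0 ≤ c) (hC : ∀ t ∈ Icc 0 T, |u t| ≤ C) (hu : ContinuousOn u (Icc 0 T))
    (hu' : ∀ t ∈ Ioc 0 T, HasDerivWithinAt u (u' t) (Icc 0 T) t)
    (h : ∀ t ∈ Ioc 0 T, g t - c ≤ u' t) : ∀ t ∈ Icc 0 T, ∫ s in (0 : ℝ)..t, g s ≤ 2 * C + c * T := by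
  intro t ht
  have hgc : Continuous fun s => g s - c := hg.sub continuous_const
  have key := intervalIntegral.integral_le_sub_of_hasDeriv_right_of_le ht.1
    (hu.mono (Icc_subset_Icc_right ht.2))
    (fun s hs => ((hu' s ⟨hs.1, hs.2.le.trans ht.2⟩).Icc_to_Ici
      ⟨hs.1.le, hs.2.trans_le ht.2⟩).mono Ioi_subset_Ici_self)
    (hgc.continuousOn.integrableOn_Icc) (fun s hs => h s ⟨hs.1, hs.2.le.trans ht.2⟩)
  rw [intervalIntegral.integral_sub (hg.intervalIntegrable _ _)
    (continuous_const.intervalIntegrable _ _), intervalIntegral.integral_const, smul_eq_mul,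
    sub_zero] at key
  have h1 := abs_le.1 (hC t ht)
  have h2 := abs_le.1 (hC 0 ⟨le_rfl, ht.1.trans ht.2⟩)
  have h3 : t * c ≤ c * T := by rw [mul_comm]; exact mul_le_mul_of_nonneg_left ht.2 hc
  linarith

/-- Global solvability of a system of ordinary differential equations indexed by `V` whose
right-hand side is Lipschitz for the supremum norm. Continuity in time is only required
componentwise, and only the time integrals of `H x · 0` need to be bounded. -/
theorem exists_bounded_solution {V : Type*} {H : V → ℝ → (V → ℝ) → ℝ} {ψ : V → ℝ}
    {T L C₀ C₁ : ℝ} (hT : 0 ≤ T) (hL : 0 < L)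
    (hLip : ∀ x t p q c, (∀ y, |p y - q y| ≤ c) → |H x t p - H x t q| ≤ L * c)
    (hcont : ∀ u : V → ℝ → ℝ, (∀ x, Continuous (u x)) →
      ∀ x, Continuous fun t => H x t fun y => u y t)
    (hint : ∀ x, ∀ t ∈ Icc 0 T, |∫ s in (0 : ℝ)..t, H x s fun _ => 0| ≤ C₀)
    (hψ : ∀ x, |ψ x| ≤ C₁) :
    ∃ u : V → ℝ → ℝ, (∃ C, ∀ x, ∀ t ∈ Icc 0 T, |u x t| ≤ C) ∧
      (∀ x, ContinuousOn (u x) (Icc 0 T)) ∧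
      (∀ x, ∀ t ∈ Icc 0 T, HasDerivWithinAt (u x) (H x t fun y => u y t) (Icc 0 T) t) ∧
      ∀ x, u x 0 = ψ x := by
  let _ : TopologicalSpace V := ⊥
  have : DiscreteTopology V := ⟨rfl⟩
  let E := BoundedContinuousFunction (V × Icc (0 : ℝ) T) ℝ
  let U : E → V → ℝ → ℝ := fun w x t => Real.exp (2 * L * t) * w (x, projIcc 0 T hT t)
  have hU : ∀ w x, Continuous (U w x) := fun w x => by
    have h1 : Continuous fun t => w (x, projIcc 0 T hT t) :=
      w.continuous.comp (continuous_const.prodMk continuous_projIcc)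
    have h2 : Continuous fun t => Real.exp (2 * L * t) := by fun_prop
    exact h2.mul h1
  have hU0 : ∀ x t, U 0 x t = 0 := fun x t => mul_zero _
  have hUdist : ∀ (w v : E) t y, |U w y t - U v y t| ≤ Real.exp (2 * L * t) * dist w v := by
    intro w v t y
    rw [← mul_sub, abs_mul, abs_of_pos (Real.exp_pos _)]
    gcongr
    exact BoundedContinuousFunction.dist_coe_le_dist (f := w) (g := v) _
  let I : E → V → ℝ → ℝ := fun w x t => ∫ s in (0 : ℝ)..t, H x s fun y => U w y s
  have hIderiv : ∀ w x t, HasDerivAt (I w x) (H x t fun y => U w y t) t := fun w x t =>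
    (hcont _ (hU w) x).integral_hasStrictDerivAt 0 t |>.hasDerivAt
  have hIdist : ∀ (w v : E) x, ∀ t, 0 ≤ t →
      |I w x t - I v x t| ≤ 1 / 2 * (Real.exp (2 * L * t) * dist w v) := by
    intro w v x t ht
    have hprim : ∀ s : ℝ, HasDerivAt (fun s => 1 / 2 * (Real.exp (2 * L * s) * dist w v))
        (L * (Real.exp (2 * L * s) * dist w v)) s := fun s => by
      have h := ((((hasDerivAt_id' s).const_mul (2 * L)).exp).mul_const (dist w v)).const_mul
        (1 / 2 : ℝ)
      exact h.congr_deriv (by ring)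
    have hc : Continuous fun s => L * (Real.exp (2 * L * s) * dist w v) := by fun_prop
    have h1 : I w x t - I v x t
        = ∫ s in (0 : ℝ)..t, (H x s fun y => U w y s) - H x s fun y => U v y s :=
      (intervalIntegral.integral_sub ((hcont _ (hU w) x).intervalIntegrable _ _)
        ((hcont _ (hU v) x).intervalIntegrable _ _)).symm
    have h2 : |I w x t - I v x t| ≤ ∫ s in (0 : ℝ)..t, L * (Real.exp (2 * L * s) * dist w v) := by
      rw [h1, ← Real.norm_eq_abs]
      exact intervalIntegral.norm_integral_le_of_norm_le ht
        (Eventually.of_forall fun s _ => hLip _ _ _ _ _ (hUdist w v s))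
        (hc.intervalIntegrable _ _)
    rw [intervalIntegral.integral_eq_sub_of_hasDerivAt (fun s _ => hprim s)
      (hc.intervalIntegrable _ _)] at h2
    have h3 : 0 ≤ 1 / 2 * (Real.exp (2 * L * 0) * dist w v) := by positivity
    linarith
  let P : E → V × Icc (0 : ℝ) T → ℝ := fun w z =>
    Real.exp (-(2 * L * z.2)) * (ψ z.1 + I w z.1 z.2)
  have hPc : ∀ w, Continuous (P w) := fun w => by
    refine continuous_prod_of_discrete_left.2 fun x => ?_
    have h1 : Continuous (I w x) :=
      continuous_iff_continuousAt.2 fun s => (hIderiv w x s).continuousAt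
    change Continuous fun t : Icc (0 : ℝ) T =>
      Real.exp (-(2 * L * (t : ℝ))) * (ψ x + I w x (t : ℝ))
    fun_prop
  have hPb : ∀ w z, ‖P w z‖ ≤ C₁ + C₀ + 1 / 2 * dist w 0 := by
    rintro w ⟨x, t, ht⟩
    have h1 := hIdist w 0 x t ht.1
    have h2 : |I 0 x t| ≤ C₀ := by simpa only [I, hU0] using hint x t ht
    have h3 := hψ x
    have h4 : Real.exp (-(2 * L * t)) ≤ 1 := Real.exp_le_one_iff.2 (by
      have := mul_nonneg hL.le ht.1
      linarith)
    have h5 : Real.exp (-(2 * L * t)) * Real.exp (2 * L * t) = 1 := by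
      rw [← Real.exp_add, neg_add_cancel, Real.exp_zero]
    have h6 : |ψ x + I w x t| ≤ (C₁ + C₀) + 1 / 2 * (Real.exp (2 * L * t) * dist w 0) := by
      have h7 : ψ x + I w x t = ψ x + I 0 x t + (I w x t - I 0 x t) := by ring
      rw [h7]
      linarith [abs_add_le (ψ x + I 0 x t) (I w x t - I 0 x t), abs_add_le (ψ x) (I 0 x t)]
    have h8 : 0 ≤ C₁ + C₀ := by linarith [abs_nonneg (ψ x), abs_nonneg (I 0 x t)]
    change ‖Real.exp (-(2 * L * t)) * (ψ x + I w x t)‖ ≤ _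
    rw [Real.norm_eq_abs, abs_mul, abs_of_pos (Real.exp_pos _)]
    calc Real.exp (-(2 * L * t)) * |ψ x + I w x t|
        ≤ Real.exp (-(2 * L * t)) *
          ((C₁ + C₀) + 1 / 2 * (Real.exp (2 * L * t) * dist w 0)) := by gcongr
      _ = Real.exp (-(2 * L * t)) * (C₁ + C₀) +
          1 / 2 * ((Real.exp (-(2 * L * t)) * Real.exp (2 * L * t)) * dist w 0) := by ring
      _ ≤ _ := by
        rw [h5, one_mul]
        have := mul_le_mul_of_nonneg_right h4 h8
        linarith
  let Φ : E → E := fun w => BoundedContinuousFunction.ofNormedAddCommGroup (P w) (hPc w) _ (hPb w)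
  have hΦ : ContractingWith (1 / 2 : NNReal) Φ := by
    refine ⟨by rw [← NNReal.coe_lt_coe]; norm_num, LipschitzWith.of_dist_le_mul fun w v => ?_⟩
    refine (BoundedContinuousFunction.dist_le (by positivity)).2 ?_
    rintro ⟨x, t, ht⟩
    change |Real.exp (-(2 * L * t)) * (ψ x + I w x t) - Real.exp (-(2 * L * t)) * (ψ x + I v x t)|
      ≤ _
    have h5 : Real.exp (-(2 * L * t)) * Real.exp (2 * L * t) = 1 := by
      rw [← Real.exp_add, neg_add_cancel, Real.exp_zero]
    rw [← mul_sub, add_sub_add_left_eq_sub, abs_mul, abs_of_pos (Real.exp_pos _)]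
    calc Real.exp (-(2 * L * t)) * |I w x t - I v x t|
        ≤ Real.exp (-(2 * L * t)) * (1 / 2 * (Real.exp (2 * L * t) * dist w v)) := by
          gcongr
          exact hIdist w v x t ht.1
      _ = 1 / 2 * ((Real.exp (-(2 * L * t)) * Real.exp (2 * L * t)) * dist w v) := by ring
      _ = _ := by rw [h5, one_mul]; norm_num
  obtain ⟨w, hw⟩ : ∃ w, Φ w = w := ⟨_, hΦ.fixedPoint_isFixedPt⟩
  have hfix : ∀ x, ∀ t ∈ Icc 0 T, U w x t = ψ x + I w x t := by
    intro x t ht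
    have h1 : w (x, ⟨t, ht⟩) = Real.exp (-(2 * L * t)) * (ψ x + I w x t) :=
      (DFunLike.congr_fun hw (x, ⟨t, ht⟩)).symm
    change Real.exp (2 * L * t) * w (x, projIcc 0 T hT t) = _
    rw [projIcc_of_mem hT ht, h1, ← mul_assoc, ← Real.exp_add, add_neg_cancel, Real.exp_zero,
      one_mul]
  refine ⟨U w, ⟨Real.exp (2 * L * T) * dist w 0, fun x t ht => ?_⟩,
    fun x => (hU w x).continuousOn, fun x t ht => ?_, fun x => ?_⟩
  · have h1 := hUdist w 0 t x
    rw [hU0, sub_zero] at h1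
    refine h1.trans ?_
    gcongr
    exact ht.2
  · exact ((hIderiv w x t).const_add (ψ x)).hasDerivWithinAt.congr (fun s hs => hfix x s hs)
      (hfix x t ht)
  · rw [hfix x 0 ⟨le_rfl, hT⟩]
    simp [I]

/-- Theorem 3.2 (upper and lower solutions method): if `D_μ < ∞`, `ū`, `u̲` are
bounded upper and lower solutions, `f(x,t,0) = 0`, `f(x,·,u)` is continuous on
`[0,T]`, and `f` is Lipschitz in `u` on `[η̲, η̄]`, then the problem
`u_t − Δu = f(x,t,u)` on `V × (0,T]`, `u(·,0) = ψ`, has a unique solution `u`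
satisfying `u̲ ≤ u ≤ ū` on `V × [0,T]`. -/
theorem stmt13 {V : Type*} [Infinite V] [Countable V]
    (ω : V → V → ℝ) (μ : V → ℝ) (hG : IsWeightedGraph ω μ) (hD : DmuFinite ω μ)
    (T : ℝ) (hT : 0 < T)
    (ψ : V → ℝ) (hψ0 : ∀ x, 0 ≤ ψ x) (hψne : ∃ x, ψ x ≠ 0)
    (f : V → ℝ → ℝ → ℝ)
    (ub lb ub' lb' : V → ℝ → ℝ)
    (hub : IsUpperSol ω μ f ψ T ub ub') (hlb : IsLowerSol ω μ f ψ T lb lb')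
    (hf0 : ∀ x, ∀ t ∈ Icc (0:ℝ) T, f x t 0 = 0)
    (hfc : ∀ x : V,
      ∀ a ∈ Icc (sInf {r : ℝ | ∃ x', ∃ t' ∈ Icc (0:ℝ) T, r = min (ub x' t') (lb x' t')})
               (sSup {r : ℝ | ∃ x', ∃ t' ∈ Icc (0:ℝ) T, r = max (ub x' t') (lb x' t')}),
        ContinuousOn (fun t => f x t a) (Icc (0:ℝ) T))
    (M : ℝ) (hM : 0 < M)
    (hLip : ∀ x, ∀ t ∈ Icc (0:ℝ) T,
      ∀ a ∈ Icc (sInf {r : ℝ | ∃ x', ∃ t' ∈ Icc (0:ℝ) T, r = min (ub x' t') (lb x' t')})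
               (sSup {r : ℝ | ∃ x', ∃ t' ∈ Icc (0:ℝ) T, r = max (ub x' t') (lb x' t')}),
      ∀ b ∈ Icc (sInf {r : ℝ | ∃ x', ∃ t' ∈ Icc (0:ℝ) T, r = min (ub x' t') (lb x' t')})
               (sSup {r : ℝ | ∃ x', ∃ t' ∈ Icc (0:ℝ) T, r = max (ub x' t') (lb x' t')}),
        |f x t a - f x t b| ≤ M * |a - b|) :
    ∃ u : V → ℝ → ℝ,
      ((∀ x, ∀ t ∈ Icc (0:ℝ) T, lb x t ≤ u x t ∧ u x t ≤ ub x t) ∧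
        (∀ x, ContinuousOn (u x) (Icc (0:ℝ) T)) ∧
        (∀ x, ∀ t ∈ Ioc (0:ℝ) T, ∃ d : ℝ, HasDerivWithinAt (u x) d (Icc (0:ℝ) T) t ∧
          d = graphLap ω μ (fun y => u y t) x + f x t (u x t)) ∧
        (∀ x, u x 0 = ψ x)) ∧
      ∀ v : V → ℝ → ℝ,
        ((∀ x, ∀ t ∈ Icc (0:ℝ) T, lb x t ≤ v x t ∧ v x t ≤ ub x t) ∧
          (∀ x, ContinuousOn (v x) (Icc (0:ℝ) T)) ∧
          (∀ x, ∀ t ∈ Ioc (0:ℝ) T, ∃ d : ℝ, HasDerivWithinAt (v x) d (Icc (0:ℝ) T) t ∧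
            d = graphLap ω μ (fun y => v y t) x + f x t (v x t)) ∧
          (∀ x, v x 0 = ψ x)) →
        ∀ x, ∀ t ∈ Icc (0:ℝ) T, v x t = u x t := by
  obtain ⟨⟨Cu, hCu⟩, hubc, hubd, hubF, hub0⟩ := hub
  obtain ⟨⟨Cl, hCl⟩, hlbc, hlbd, hlbF, hlb0⟩ := hlb
  set a₀ := sInf {r : ℝ | ∃ x', ∃ t' ∈ Icc (0:ℝ) T, r = min (ub x' t') (lb x' t')}
  set b₀ := sSup {r : ℝ | ∃ x', ∃ t' ∈ Icc (0:ℝ) T, r = max (ub x' t') (lb x' t')}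
  have hle : ∀ x, ∀ t ∈ Icc (0:ℝ) T,
      a₀ ≤ min (ub x t) (lb x t) ∧ max (ub x t) (lb x t) ≤ b₀ := by
    refine fun x t ht => ⟨csInf_le ⟨min (-Cu) (-Cl), ?_⟩ ⟨x, t, ht, rfl⟩,
      le_csSup ⟨max Cu Cl, ?_⟩ ⟨x, t, ht, rfl⟩⟩
    · rintro _ ⟨y, s, hs, rfl⟩
      exact min_le_min (abs_le.1 (hCu y s hs)).1 (abs_le.1 (hCl y s hs)).1
    · rintro _ ⟨y, s, hs, rfl⟩
      exact max_le_max (abs_le.1 (hCu y s hs)).2 (abs_le.1 (hCl y s hs)).2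
  have hubI : ∀ x, ∀ t ∈ Icc (0:ℝ) T, ub x t ∈ Icc a₀ b₀ := fun x t ht =>
    ⟨(hle x t ht).1.trans (min_le_left _ _), (le_max_left _ _).trans (hle x t ht).2⟩
  have hlbI : ∀ x, ∀ t ∈ Icc (0:ℝ) T, lb x t ∈ Icc a₀ b₀ := fun x t ht =>
    ⟨(hle x t ht).1.trans (min_le_right _ _), (le_max_right _ _).trans (hle x t ht).2⟩
  have hmemI : ∀ u : V → ℝ → ℝ, (∀ x, ∀ t ∈ Icc (0:ℝ) T, lb x t ≤ u x t ∧ u x t ≤ ub x t) →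
      ∀ x, ∀ t ∈ Icc (0:ℝ) T, u x t ∈ Icc a₀ b₀ := fun u hu x t ht =>
    ⟨(hlbI x t ht).1.trans (hu x t ht).1, (hu x t ht).2.trans (hubI x t ht).2⟩
  have hmemC : ∀ u : V → ℝ → ℝ, (∀ x, ∀ t ∈ Icc (0:ℝ) T, lb x t ≤ u x t ∧ u x t ≤ ub x t) →
      ∀ x, ∀ t ∈ Icc (0:ℝ) T, |u x t| ≤ max Cl Cu := fun u hu x t ht =>
    (abs_le_max_abs_abs (hu x t ht).1 (hu x t ht).2).trans
      (max_le_max (hCl x t ht) (hCu x t ht))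
  obtain ⟨x₀, -⟩ := hψne
  have hT0 : (0 : ℝ) ∈ Icc 0 T := ⟨le_rfl, hT.le⟩
  have hab : a₀ ≤ b₀ := (hubI x₀ 0 hT0).1.trans (hubI x₀ 0 hT0).2
  let F : V → ℝ → ℝ → ℝ := fun x t a => f x (projIcc 0 T hT.le t) (projIcc a₀ b₀ hab a)
  have hFeq : ∀ x, ∀ t ∈ Icc (0:ℝ) T, ∀ a ∈ Icc a₀ b₀, F x t a = f x t a := fun x t ht a ha => by
    simp only [F, projIcc_of_mem hT.le ht, projIcc_of_mem hab ha]
  have hFLip : ∀ x t a b, |F x t a - F x t b| ≤ M * |a - b| := fun x t a b =>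
    (hLip x _ (Subtype.prop _) _ (Subtype.prop _) _ (Subtype.prop _)).trans
      (mul_le_mul_of_nonneg_left (abs_projIcc_sub_projIcc hab) hM.le)
  have hFc : ∀ x, Continuous fun z : ℝ × ℝ => F x z.1 z.2 := fun x =>
    continuous_prod_of_continuous_lipschitzWith' _ M.toNNReal
      (fun t => LipschitzWith.of_dist_le_mul fun a b => by
        rw [Real.coe_toNNReal M hM.le]
        exact hFLip x t a b)
      fun a => (hfc x (projIcc a₀ b₀ hab a) (Subtype.prop _)).comp_continuous
        (continuous_subtype_val.comp (continuous_projIcc (h := hT.le))) fun t => Subtype.prop _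
  obtain ⟨D, hD0, hD⟩ : ∃ D : ℝ, 0 ≤ D ∧ ∀ x, (∑' y, ω x y) ≤ D * μ x := by
    obtain ⟨D, hD⟩ := hD
    exact ⟨max D 0, le_max_right _ _, fun x => (hD x).trans
      (mul_le_mul_of_nonneg_right (le_max_left _ _) (hG.measurePos x).le)⟩
  have hCu0 : 0 ≤ Cu := (abs_nonneg _).trans (hCu x₀ 0 hT0)
  have hCl0 : 0 ≤ Cl := (abs_nonneg _).trans (hCl x₀ 0 hT0)
  have hF0c : ∀ x, Continuous fun t => F x t 0 := fun x =>
    (hFc x).comp (continuous_id.prodMk continuous_const)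
  have hIoc : ∀ t ∈ Ioc (0:ℝ) T, t ∈ Icc (0:ℝ) T := fun t ht => ⟨ht.1.le, ht.2⟩
  have hupper : ∀ x, ∀ t ∈ Icc (0:ℝ) T,
      ∫ s in (0:ℝ)..t, F x s 0 ≤ 2 * Cu + (M * Cu + 2 * D * Cu) * T := fun x =>
    integral_le_of_sub_le_deriv (hF0c x) (by positivity) (hCu x) (hubc x) (hubd x)
      fun t ht => by
        have h1 := hubF x t ht
        rw [← hFeq x t (hIoc t ht) _ (hubI x t (hIoc t ht))] at h1
        have h2 := hFLip x t 0 (ub x t)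
        rw [zero_sub, abs_neg] at h2
        have h3 := mul_le_mul_of_nonneg_left (hCu x t (hIoc t ht)) hM.le
        have h4 := abs_graphLap_le hG hD (fun y => hCu y t (hIoc t ht)) x
        linarith [(abs_le.1 h2).2, (abs_le.1 h4).1]
  have hlower : ∀ x, ∀ t ∈ Icc (0:ℝ) T,
      ∫ s in (0:ℝ)..t, -F x s 0 ≤ 2 * Cl + (M * Cl + 2 * D * Cl) * T := fun x =>
    integral_le_of_sub_le_deriv (hF0c x).neg (by positivity)
      (fun t ht => (abs_neg _).trans_le (hCl x t ht)) (hlbc x).neg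
      (fun t ht => (hlbd x t ht).neg)
      fun t ht => by
        have h1 := hlbF x t ht
        rw [← hFeq x t (hIoc t ht) _ (hlbI x t (hIoc t ht))] at h1
        have h2 := hFLip x t 0 (lb x t)
        rw [zero_sub, abs_neg] at h2
        have h3 := mul_le_mul_of_nonneg_left (hCl x t (hIoc t ht)) hM.le
        have h4 := abs_graphLap_le hG hD (fun y => hCl y t (hIoc t ht)) x
        linarith [(abs_le.1 h2).1, (abs_le.1 h4).2]
  obtain ⟨u, ⟨C, hC⟩, huc, hud, hu0⟩ := exists_bounded_solution
    (H := fun x t p => graphLap ω μ p x + F x t (p x)) (ψ := ψ) (T := T) (L := 2 * D + M)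
    (C₀ := max (2 * Cu + (M * Cu + 2 * D * Cu) * T) (2 * Cl + (M * Cl + 2 * D * Cl) * T))
    (C₁ := max Cl Cu) hT.le (by positivity)
    (fun x t p q c h => by
      have h1 := abs_graphLap_le hG hD h x
      rw [graphLap_sub hG] at h1
      have h2 := (hFLip x t (p x) (q x)).trans (mul_le_mul_of_nonneg_left (h x) hM.le)
      rw [add_sub_add_comm, add_mul]
      exact (abs_add_le _ _).trans (add_le_add h1 h2))
    (fun u hu x => (continuous_graphLap hG hu x).add
      ((hFc x).comp (continuous_id.prodMk (hu x))))
    (fun x t ht => by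
      simp only [graphLap_zero, zero_add]
      have h1 := hlower x t ht
      rw [intervalIntegral.integral_neg] at h1
      exact abs_le.2 ⟨neg_le.1 (h1.trans (le_max_right _ _)), (hupper x t ht).trans (le_max_left _ _)⟩)
    (fun x => (abs_le_max_abs_abs (hlb0 x) (hub0 x)).trans
      (max_le_max (hCl x 0 hT0) (hCu x 0 hT0)))
  have hu_le : ∀ x, ∀ t ∈ Icc (0:ℝ) T, u x t ≤ ub x t :=
    le_of_parabolic_le hG hD0 hD hM hFLip hCu hC hubc huc hubd
      (fun x t ht => hud x t (hIoc t ht))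
      (fun x t ht => by rw [hFeq x t (hIoc t ht) _ (hubI x t (hIoc t ht))]; exact hubF x t ht)
      (fun x t ht => (add_sub_cancel_left _ _).le) (fun x => by rw [hu0]; exact hub0 x)
  have hle_u : ∀ x, ∀ t ∈ Icc (0:ℝ) T, lb x t ≤ u x t :=
    le_of_parabolic_le hG hD0 hD hM hFLip hC hCl huc hlbc
      (fun x t ht => hud x t (hIoc t ht)) hlbd
      (fun x t ht => (add_sub_cancel_left _ _).ge)
      (fun x t ht => by rw [hFeq x t (hIoc t ht) _ (hlbI x t (hIoc t ht))]; exact hlbF x t ht)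
      (fun x => by rw [hu0]; exact hlb0 x)
  have huI := hmemI u fun x t ht => ⟨hle_u x t ht, hu_le x t ht⟩
  refine ⟨u, ⟨fun x t ht => ⟨hle_u x t ht, hu_le x t ht⟩, huc, fun x t ht =>
    ⟨_, hud x t (hIoc t ht), ?_⟩, hu0⟩, ?_⟩
  · rw [hFeq x t (hIoc t ht) _ (huI x t (hIoc t ht))]
  rintro v ⟨hvb, hvc, hvd, hv0⟩
  have hvd' : ∀ x, ∀ t ∈ Ioc (0:ℝ) T, HasDerivWithinAt (v x)
      (graphLap ω μ (fun y => v y t) x + F x t (v x t)) (Icc 0 T) t := fun x t ht => by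
    obtain ⟨d, hd, rfl⟩ := hvd x t ht
    rwa [hFeq x t (hIoc t ht) _ (hmemI v hvb x t (hIoc t ht))]
  refine fun x t ht => le_antisymm ?_ ?_
  · exact le_of_parabolic_le hG hD0 hD hM hFLip hC (hmemC v hvb) huc hvc
      (fun x t ht => hud x t (hIoc t ht)) hvd' (fun x t ht => (add_sub_cancel_left _ _).ge)
      (fun x t ht => (add_sub_cancel_left _ _).le) (fun x => by rw [hu0, hv0]) x t ht
  · exact le_of_parabolic_le hG hD0 hD hM hFLip (hmemC v hvb) hC hvc huc
      hvd' (fun x t ht => hud x t (hIoc t ht)) (fun x t ht => (add_sub_cancel_left _ _).ge)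
      (fun x t ht => (add_sub_cancel_left _ _).le) (fun x => by rw [hu0, hv0]) x t ht
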